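/- arXiv:cs/0307029 — 10 statements merged into one kernel-verified Lean document; each statement's English description precedes it below -/
import Mathlib

section
/- Let e, m, n be natural numbers with n > 1, e ≥ 1, gcd(m, n) = 1 and gcd(e, λ(n)) = 1. Then there is a least k ≥ 1 such that m^(e^k) ≡ m (mod n), and this least k (the (n,e)-iteration exponent s(n,e,m) of m) divides λ(λ(n)). -/
/-- The Carmichael function, realized as the exponent of the unit group of `ZMod n`. -/
noncomputable def carmichael (n : ℕ) : ℕ := Monoid.exponent (ZMod n)ˣ

theorem iteration_exponent_dvd (e m n : ℕ) (hn : 1 < n) (he : 1 ≤ e)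
    (hmn : Nat.gcd m n = 1) (hel : Nat.gcd e (carmichael n) = 1) :
    ∃ k : ℕ, 1 ≤ k ∧ m ^ (e ^ k) ≡ m [MOD n] ∧
      (∀ j : ℕ, 1 ≤ j → m ^ (e ^ j) ≡ m [MOD n] → k ≤ j) ∧
      k ∣ carmichael (carmichael n) := by
  haveI : NeZero n := ⟨by omega⟩
  let u : (ZMod n)ˣ := ZMod.unitOfCoprime m hmn
  have hdvd : orderOf u ∣ carmichael n := Monoid.order_dvd_exponent u
  haveI : NeZero (orderOf u) := ⟨(orderOf_pos u).ne'⟩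
  have hed : Nat.Coprime e (orderOf u) := Nat.Coprime.coprime_dvd_right hdvd hel
  let v : (ZMod (orderOf u))ˣ := ZMod.unitOfCoprime e hed
  let w : (ZMod (carmichael n))ˣ := ZMod.unitOfCoprime e hel
  have key : ∀ j : ℕ, m ^ (e ^ j) ≡ m [MOD n] ↔ v ^ j = 1 := by
    intro j
    have h1 : m ^ (e ^ j) ≡ m [MOD n] ↔ u ^ (e ^ j) = u ^ 1 := by
      rw [← ZMod.natCast_eq_natCast_iff, Units.ext_iff]
      simp [u, ZMod.coe_unitOfCoprime]
    have h2 : v ^ j = 1 ↔ e ^ j ≡ 1 [MOD orderOf u] := by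
      rw [← ZMod.natCast_eq_natCast_iff, Units.ext_iff]
      simp [v, ZMod.coe_unitOfCoprime]
    rw [h1, h2, pow_eq_pow_iff_modEq]
  refine ⟨orderOf v, orderOf_pos v, (key _).2 (pow_orderOf_eq_one v), ?_, ?_⟩
  · intro j hj h
    exact orderOf_le_of_pow_eq_one hj ((key j).1 h)
  · have hv : ZMod.unitsMap hdvd w = v := by
      ext
      simp [v, w, ZMod.unitsMap_def, ZMod.coe_unitOfCoprime]
    rw [← hv]
    exact (orderOf_map_dvd _ w).trans (Monoid.order_dvd_exponent w)
end

section
/- Let d, e, n be natural numbers with n > 1, gcd(e, n) = 1, and d·e ≡ 1 (mod λ(n)). Then ω_e(ω_e(n)) > 0, and d ≡ e^(ω_e(ω_e(n)) − 1) (mod ω_e(n)). -/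
theorem ray_attack_d_eq (d e n : ℕ) (hn : 1 < n) (hen : Nat.gcd e n = 1)
    (hde : d * e ≡ 1 [MOD carmichael n]) :
    0 < orderOf ((e : ZMod (orderOf (e : ZMod n)))) ∧
    d ≡ e ^ (orderOf ((e : ZMod (orderOf (e : ZMod n)))) - 1)
      [MOD orderOf (e : ZMod n)] := by
  have hm : orderOf (e : ZMod n) ∣ carmichael n := by
    have h := Monoid.order_dvd_exponent (ZMod.unitOfCoprime e hen)
    rw [← orderOf_units, ZMod.coe_unitOfCoprime] at h
    exact h
  have hpos : 0 < orderOf (e : ZMod n) := by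
    haveI : NeZero n := ⟨by omega⟩
    have h := orderOf_pos (ZMod.unitOfCoprime e hen)
    rw [← orderOf_units, ZMod.coe_unitOfCoprime] at h
    exact h
  have h1 := hde.of_dvd hm
  generalize orderOf (e : ZMod n) = m at hpos h1
  haveI : NeZero m := ⟨by omega⟩
  have h2 : (d : ZMod m) * e = 1 := by
    have := (ZMod.natCast_eq_natCast_iff _ _ _).2 h1
    simpa using this
  have hk : 0 < orderOf (e : ZMod m) := by
    have h := orderOf_pos (Units.mkOfMulEqOne (e : ZMod m) d (by rw [mul_comm]; exact h2))
    rw [← orderOf_units] at h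
    exact h
  refine ⟨hk, ?_⟩
  rw [← ZMod.natCast_eq_natCast_iff]
  push_cast
  have h3 : (e : ZMod m) ^ (orderOf (e : ZMod m) - 1) * e = 1 := by
    rw [← pow_succ, Nat.sub_add_cancel hk, pow_orderOf_eq_one]
  calc (d : ZMod m) = ((e : ZMod m) ^ (orderOf (e : ZMod m) - 1) * e) * d := by rw [h3, one_mul]
    _ = (e : ZMod m) ^ (orderOf (e : ZMod m) - 1) * (d * e) := by ring
    _ = _ := by rw [h2, mul_one]
end

section
/- Let e, n, a, b be natural numbers with n > 1, gcd(e, n) = 1, a ≥ 1, b ≥ 1, gcd(e, a·ω_e(n)) = 1, and suppose a·ω_e(n) divides λ(n). Set w = ω_e(a·ω_e(n)) and d̃ = e^(b·w − 1) mod (a·ω_e(n)). Then every integer d with d·e ≡ 1 (mod λ(n)) satisfies d ≡ d̃ (mod a·ω_e(n)). -/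
theorem ray_attack_d_unique (e n a b : ℕ) (hn : 1 < n) (hen : Nat.gcd e n = 1)
    (ha : 1 ≤ a) (hb : 1 ≤ b) (hea : Nat.gcd e (a * orderOf (e : ZMod n)) = 1)
    (hdvd : a * orderOf (e : ZMod n) ∣ carmichael n) :
    ∀ d : ℤ, d * e ≡ 1 [ZMOD (carmichael n : ℤ)] →
      d ≡ ((e ^ (b * orderOf ((e : ZMod (a * orderOf (e : ZMod n)))) - 1)
            % (a * orderOf (e : ZMod n)) : ℕ) : ℤ)
        [ZMOD ((a * orderOf (e : ZMod n) : ℕ) : ℤ)] := by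
  intro d hd
  have hM : a * orderOf (e : ZMod n) ≠ 0 := by
    intro h0
    rw [h0, zero_dvd_iff] at hdvd
    haveI : NeZero n := ⟨by omega⟩
    exact Monoid.exponent_ne_zero_of_finite (G := (ZMod n)ˣ) hdvd
  have hd' : d * e ≡ 1 [ZMOD ((a * orderOf (e : ZMod n) : ℕ) : ℤ)] :=
    hd.of_dvd (Int.natCast_dvd_natCast.mpr hdvd)
  generalize a * orderOf (e : ZMod n) = M at *
  haveI : NeZero M := ⟨hM⟩
  rw [← ZMod.intCast_eq_intCast_iff] at hd' ⊢
  push_cast at hd' ⊢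
  have hw : 0 < orderOf (e : ZMod M) := by
    have h := orderOf_pos (ZMod.unitOfCoprime e hea)
    rwa [← orderOf_units, ZMod.coe_unitOfCoprime] at h
  have hpow : (e : ZMod M) ^ (b * orderOf (e : ZMod M)) = 1 := by
    rw [mul_comm, pow_mul, pow_orderOf_eq_one, one_pow]
  have hbw : 0 < b * orderOf (e : ZMod M) := Nat.mul_pos hb hw
  generalize b * orderOf (e : ZMod M) = k at *
  obtain ⟨k, rfl⟩ : ∃ j, k = j + 1 := ⟨k - 1, by omega⟩
  have key : (d : ZMod M) = (e : ZMod M) ^ k := by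
    calc (d : ZMod M) = d * (e : ZMod M) ^ (k + 1) := by rw [hpow, mul_one]
      _ = (d * e) * (e : ZMod M) ^ k := by ring
      _ = _ := by rw [hd', one_mul]
  rw [key, Nat.add_sub_cancel]
end

section
/- Let n > 2 be a squarefree natural number and let e, a, b be natural numbers with gcd(e, n) = 1, a ≥ 1, b ≥ 1, gcd(e, a·ω_e(n)) = 1, and suppose λ(n) divides a·ω_e(n). Set w = ω_e(a·ω_e(n)) and d̃ = e^(b·w − 1) mod (a·ω_e(n)). Then for every m in ZMod n one has m^(e·d̃) = m. -/
theorem pow_eq_self_aux (n k N : ℕ) (hsf : Squarefree n) (hk : k ≠ 0) (hkN : k ≡ 1 [MOD N])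
    (hdvd : Monoid.exponent (ZMod n)ˣ ∣ N) (m : ZMod n) : m ^ k = m := by
  have hn0 : n ≠ 0 := hsf.ne_zero
  have : NeZero n := ⟨hn0⟩
  obtain ⟨z, rfl⟩ := ZMod.intCast_surjective m
  obtain ⟨t, ht⟩ : N ∣ k - 1 := (Nat.modEq_iff_dvd' (by omega)).1 hkN.symm
  have hk1 : k = N * t + 1 := by omega
  suffices h : (n : ℤ) ∣ z ^ k - z by
    have := (ZMod.intCast_zmod_eq_zero_iff_dvd _ n).2 h
    push_cast at this
    exact sub_eq_zero.1 this
  rw [← Nat.prod_primeFactors_of_squarefree hsf]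
  push_cast
  apply Finset.prod_dvd_of_coprime
  · intro p hp q hq hpq
    have h1 := Nat.prime_of_mem_primeFactors hp
    have h2 := Nat.prime_of_mem_primeFactors hq
    exact ((Nat.coprime_primes h1 h2).2 hpq).isCoprime
  · intro p hp
    have h1 := Nat.prime_of_mem_primeFactors hp
    have hpn := Nat.dvd_of_mem_primeFactors hp
    have : Fact p.Prime := ⟨h1⟩
    rw [← ZMod.intCast_zmod_eq_zero_iff_dvd]
    push_cast
    rw [sub_eq_zero]
    by_cases hz : (z : ZMod p) = 0
    · rw [hz, zero_pow hk]
    · obtain ⟨u, hu⟩ := ZMod.unitsMap_surjective hpn (Units.mk0 _ hz)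
      have huN : u ^ N = 1 := by
        obtain ⟨s, rfl⟩ := hdvd
        rw [pow_mul, Monoid.pow_exponent_eq_one, one_pow]
      have hv : (Units.mk0 _ hz) ^ N = 1 := by rw [← hu, ← map_pow, huN, map_one]
      have hv' : (z : ZMod p) ^ N = 1 := by simpa using congrArg Units.val hv
      rw [hk1, pow_succ, pow_mul, hv', one_pow, one_mul]

theorem ray_attack_all_messages (n e a b : ℕ) (hn : 2 < n) (hsf : Squarefree n)
    (hen : Nat.gcd e n = 1) (ha : 1 ≤ a) (hb : 1 ≤ b)
    (hea : Nat.gcd e (a * orderOf (e : ZMod n)) = 1)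
    (hdvd : carmichael n ∣ a * orderOf (e : ZMod n)) :
    ∀ m : ZMod n,
      m ^ (e * (e ^ (b * orderOf ((e : ZMod (a * orderOf (e : ZMod n)))) - 1)
        % (a * orderOf (e : ZMod n)))) = m := by
  intro m
  have : NeZero n := ⟨by omega⟩
  have hpos : ∀ M : ℕ, M ≠ 0 → Nat.gcd e M = 1 → 0 < orderOf (e : ZMod M) := by
    intro M hM h
    have : NeZero M := ⟨hM⟩
    rw [← ZMod.coe_unitOfCoprime e h, orderOf_units]
    exact orderOf_pos _
  have ho := hpos n (by omega) hen
  generalize hN : a * orderOf (e : ZMod n) = N at *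
  have hN0 : N ≠ 0 := by rw [← hN]; positivity
  have hN1 : N ≠ 1 := by
    rintro rfl
    have : Fact (2 < n) := ⟨hn⟩
    have h1 : Monoid.exponent (ZMod n)ˣ = 1 := Nat.dvd_one.1 hdvd
    have h2 := Monoid.pow_exponent_eq_one (-1 : (ZMod n)ˣ)
    rw [h1, pow_one] at h2
    exact ZMod.neg_one_ne_one (by simpa using congrArg Units.val h2)
  have hw := hpos N hN0 hea
  have hmod : e * (e ^ (b * orderOf (e : ZMod N) - 1) % N) ≡ 1 [MOD N] := by
    refine ((Nat.mod_modEq _ N).mul_left e).trans ?_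
    rw [← pow_succ', Nat.sub_add_cancel (Nat.mul_pos hb hw), ← ZMod.natCast_eq_natCast_iff]
    push_cast
    rw [mul_comm, pow_mul, pow_orderOf_eq_one, one_pow]
  refine pow_eq_self_aux n _ N hsf ?_ hmod hdvd m
  intro h0
  rw [h0] at hmod
  exact hN1 (Nat.dvd_one.1 ((Nat.modEq_zero_iff_dvd).1 hmod.symm))
end

section
/- Let n = p·q where p < q are primes, and let p_min be a natural number with 1 ≤ p_min ≤ p. Then, as real numbers, φ(n) ≥ (p_min − 1)·(n/p_min − 1); moreover the inequality is strict if p_min < p. -/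
theorem totient_ray_bound (p q n : ℕ) (hp : p.Prime) (hq : q.Prime) (hpq : p < q)
    (hn : n = p * q) (pmin : ℕ) (h1 : 1 ≤ pmin) (h2 : pmin ≤ p) :
    ((Nat.totient n : ℝ) ≥ ((pmin : ℝ) - 1) * ((n : ℝ) / (pmin : ℝ) - 1)) ∧
    (pmin < p → (Nat.totient n : ℝ) > ((pmin : ℝ) - 1) * ((n : ℝ) / (pmin : ℝ) - 1)) := by
  have hm : (0 : ℝ) < pmin := by exact_mod_cast h1
  have hc : Nat.Coprime p q := (Nat.coprime_primes hp hq).2 hpq.ne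
  have ht : (Nat.totient n : ℝ) = ((p : ℝ) - 1) * ((q : ℝ) - 1) := by
    rw [hn, Nat.totient_mul hc, Nat.totient_prime hp, Nat.totient_prime hq, Nat.cast_mul,
      Nat.cast_sub hp.one_le, Nat.cast_sub hq.one_le, Nat.cast_one]
  have key : (Nat.totient n : ℝ) = ((pmin : ℝ) - 1) * ((n : ℝ) / (pmin : ℝ) - 1)
      + ((p : ℝ) - pmin) * ((q : ℝ) - pmin) / pmin := by
    rw [ht, hn, Nat.cast_mul]
    field_simp
    ring
  have hq' : (0 : ℝ) < (q : ℝ) - pmin := by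
    have : (pmin : ℝ) < q := by exact_mod_cast lt_of_le_of_lt h2 hpq
    linarith
  constructor
  · have hp' : (0 : ℝ) ≤ (p : ℝ) - pmin := by
      have : (pmin : ℝ) ≤ p := by exact_mod_cast h2
      linarith
    have : 0 ≤ ((p : ℝ) - pmin) * ((q : ℝ) - pmin) / pmin := by positivity
    linarith
  · intro h
    have hp' : (0 : ℝ) < (p : ℝ) - pmin := by
      have : (pmin : ℝ) < p := by exact_mod_cast h
      linarith
    have : 0 < ((p : ℝ) - pmin) * ((q : ℝ) - pmin) / pmin := by positivity
    linarith
end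

section
/- Let p < q be primes, n = p·q, and e > 1 a natural number with gcd(e, n) = 1. Set δ = ⌊log_e n⌋ (the largest i with e^i ≤ n), Δ = p + q + δ, and let r₊ and r₋ be the real numbers r± = (Δ ± √(Δ² − 4n))/2. Let f(r) = (r − 1)·(n/r − 1) (real-valued). Suppose r is a natural number with r₋ ≤ r ≤ p or q ≤ r ≤ r₊, and b is a natural number with 0 < b < n and b·e^⌊f(r)⌋ ≡ 1 (mod n). Then φ(n) = γ + ⌊f(r)⌋, where γ is the largest natural number i such that e^i divides b. -/
theorem euler_ray_guess (p q n e : ℕ) (hp : p.Prime) (hq : q.Prime) (hpq : p < q)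
    (hn : n = p * q) (he : 1 < e) (hen : Nat.gcd e n = 1)
    (δ : ℕ) (hδ : δ = Nat.log e n)
    (Δ : ℕ) (hΔ : Δ = p + q + δ)
    (rm rp : ℝ) (hrm : rm = ((Δ : ℝ) - Real.sqrt ((Δ : ℝ) ^ 2 - 4 * (n : ℝ))) / 2)
    (hrp : rp = ((Δ : ℝ) + Real.sqrt ((Δ : ℝ) ^ 2 - 4 * (n : ℝ))) / 2)
    (f : ℝ → ℝ) (hf : ∀ x : ℝ, f x = (x - 1) * ((n : ℝ) / x - 1))
    (r : ℕ) (hr : (rm ≤ (r : ℝ) ∧ r ≤ p) ∨ ((q : ℕ) ≤ r ∧ (r : ℝ) ≤ rp))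
    (b : ℕ) (hb0 : 0 < b) (hbn : b < n)
    (hbe : b * e ^ (⌊f (r : ℝ)⌋).toNat ≡ 1 [MOD n]) :
    (Nat.totient n : ℤ) = (Nat.maxPowDiv e b : ℤ) + ⌊f (r : ℝ)⌋ := by
  have hp0 := hp.pos
  have hq0 := hq.pos
  have hn1 : 1 < n := by rw [hn]; nlinarith [hp.two_le, hq.two_le]
  have hcop : Nat.Coprime e n := hen
  have htot : Nat.totient n = (p - 1) * (q - 1) := by
    rw [hn, Nat.totient_mul ((Nat.coprime_primes hp hq).2 hpq.ne), Nat.totient_prime hp,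
      Nat.totient_prime hq]
  have htotZ : (Nat.totient n : ℤ) = n - p - q + 1 := by
    rw [htot, hn]; push_cast [Nat.cast_sub hp.one_le, Nat.cast_sub hq.one_le]; ring
  have heul : e ^ Nat.totient n ≡ 1 [MOD n] := Nat.ModEq.pow_totient hcop
  have hφ0 : Nat.totient n ≠ 0 := (Nat.totient_pos.2 (by omega)).ne'
  have hδle : e ^ δ ≤ n := by rw [hδ]; exact Nat.pow_log_le_self e (by omega)
  have hδφ : δ < Nat.totient n := by
    by_contra h
    push Not at h
    have h1 : 1 < e ^ Nat.totient n := Nat.one_lt_pow hφ0 he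
    have h2 : e ^ Nat.totient n ≤ e ^ δ := Nat.pow_le_pow_right (by omega) h
    have h3 : n ∣ e ^ Nat.totient n - 1 := (Nat.modEq_iff_dvd' h1.le).1 heul.symm
    have := Nat.le_of_dvd (by omega) h3
    omega
  have hnR : (n : ℝ) = p * q := by rw [hn]; push_cast; ring
  have hΔR : (Δ : ℝ) = p + q + δ := by rw [hΔ]; push_cast; ring
  have hpR : (0 : ℝ) < p := by exact_mod_cast hp0
  have hqR : (0 : ℝ) < q := by exact_mod_cast hq0
  have hpqR : (p : ℝ) < q := by exact_mod_cast hpq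
  have hδR : (0 : ℝ) ≤ δ := by positivity
  have hD : 0 ≤ (Δ : ℝ) ^ 2 - 4 * (n : ℝ) := by
    rw [hΔR, hnR]; nlinarith [sq_nonneg ((p : ℝ) - q), mul_nonneg hδR hpR.le, mul_nonneg hδR hqR.le]
  have hs := Real.sq_sqrt hD
  have hs0 := Real.sqrt_nonneg ((Δ : ℝ) ^ 2 - 4 * (n : ℝ))
  set s := Real.sqrt ((Δ : ℝ) ^ 2 - 4 * (n : ℝ)) with hsdef
  have hsge : (q : ℝ) - p + δ ≤ s := by
    apply Real.le_sqrt_of_sq_le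
    rw [hΔR, hnR]; nlinarith [mul_nonneg hδR hpR.le]
  have hboth : rm ≤ r ∧ (r : ℝ) ≤ rp := by
    rcases hr with ⟨h1, h2⟩ | ⟨h1, h2⟩
    · have h2' : (r : ℝ) ≤ p := by exact_mod_cast h2
      exact ⟨h1, by rw [hrp]; linarith⟩
    · have h1' : (q : ℝ) ≤ r := by exact_mod_cast h1
      exact ⟨by rw [hrm]; linarith, h2⟩
  have hquad : (r : ℝ) ^ 2 - Δ * r + n ≤ 0 := by
    have := mul_nonneg (sub_nonneg.2 hboth.1) (sub_nonneg.2 hboth.2)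
    rw [hrm, hrp] at this
    nlinarith
  have hlow : 0 ≤ (r : ℝ) ^ 2 - (p + q) * r + n := by
    rw [hnR]
    rcases hr with ⟨_, h2⟩ | ⟨h1, _⟩
    · have h2' : (r : ℝ) ≤ p := by exact_mod_cast h2
      nlinarith [mul_nonneg (sub_nonneg.2 h2') (sub_nonneg.2 (h2'.trans hpqR.le))]
    · have h1' : (q : ℝ) ≤ r := by exact_mod_cast h1
      nlinarith [mul_nonneg (sub_nonneg.2 h1') (sub_nonneg.2 (hpqR.le.trans h1'))]
  have hr0 : (0 : ℝ) < r := by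
    rcases Nat.eq_zero_or_pos r with h | h
    · rw [h, hnR] at hquad
      have := mul_pos hpR hqR
      norm_num at hquad
      linarith
    · exact_mod_cast h
  have hfr : f r = n + 1 - ((r : ℝ) ^ 2 + n) / r := by
    rw [hf]; field_simp; ring
  have hup : ((r : ℝ) ^ 2 + n) / r ≤ p + q + δ := by
    rw [div_le_iff₀ hr0, ← hΔR]; linarith
  have hlo : (p : ℝ) + q ≤ ((r : ℝ) ^ 2 + n) / r := by
    rw [le_div_iff₀ hr0]; linarith
  have hk1 : (Nat.totient n : ℤ) - δ ≤ ⌊f (r : ℝ)⌋ := by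
    rw [Int.le_floor, hfr, htotZ]; push_cast; linarith
  have hk2 : ⌊f (r : ℝ)⌋ ≤ (Nat.totient n : ℤ) := by
    have h : f r ≤ ((Nat.totient n : ℤ) : ℝ) := by
      rw [hfr, htotZ]; push_cast; linarith
    exact_mod_cast (Int.floor_le _).trans h
  generalize ⌊f (r : ℝ)⌋ = k at *
  lift k to ℕ using (by omega)
  rw [Int.toNat_natCast] at hbe
  obtain ⟨d, hd⟩ : ∃ d, Nat.totient n = d + k := ⟨Nat.totient n - k, by omega⟩
  have hdδ : d ≤ δ := by omega
  have hbd : b ≡ e ^ d [MOD n] := by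
    have h : b * e ^ k ≡ e ^ d * e ^ k [MOD n] := by
      rw [← pow_add, ← hd]; exact hbe.trans heul.symm
    exact Nat.ModEq.cancel_right_of_coprime (hcop.symm.pow_right k) h
  have hlt : e ^ d < n := by
    refine lt_of_le_of_ne ((Nat.pow_le_pow_right (by omega) hdδ).trans hδle) fun h => ?_
    have h1 : Nat.Coprime (e ^ d) n := hcop.pow_left d
    rw [h, Nat.coprime_self] at h1
    omega
  have hbeq : b = e ^ d := Nat.ModEq.eq_of_lt_of_lt hbd hbn hlt
  have hmax : Nat.maxPowDiv e b = d := by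
    rw [hbeq]
    change padicValNat e (e ^ d) = d
    have hne : e ^ d ≠ 0 := (Nat.pow_pos (by omega)).ne'
    apply le_antisymm
    · exact (Nat.pow_dvd_pow_iff_le_right he).1 pow_padicValNat_dvd
    · exact (Nat.pow_dvd_iff_le_padicValNat he.ne' hne).1 dvd_rfl
  rw [hmax, hd]; push_cast; ring
end

section
/- Let p < q be primes, n = p·q, and e a natural number with 1 < e ≤ n. Set δ = ⌊log_e n⌋, Δ = p + q + δ, and r₊ = (Δ + √(Δ² − 4n))/2 (a real number; Δ² − 4n > 0). Then r₊ − q > δ/2. -/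
theorem coarse_grain_upper (p q n e : ℕ) (hp : p.Prime) (hq : q.Prime) (hpq : p < q)
    (hn : n = p * q) (he : 1 < e) (hen : e ≤ n)
    (δ : ℕ) (hδ : δ = Nat.log e n)
    (Δ : ℕ) (hΔ : Δ = p + q + δ)
    (rp : ℝ) (hrp : rp = ((Δ : ℝ) + Real.sqrt ((Δ : ℝ) ^ 2 - 4 * (n : ℝ))) / 2) :
    rp - (q : ℝ) > (δ : ℝ) / 2 := by
  have h1 : 0 < δ := hδ ▸ Nat.log_pos he hen
  have h1' : (0 : ℝ) < δ := by exact_mod_cast h1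
  have hp' : (0 : ℝ) < p := by exact_mod_cast hp.pos
  have hq' : (0 : ℝ) < q := by exact_mod_cast hq.pos
  have hpq' : (p : ℝ) < q := by exact_mod_cast hpq
  have key : (q : ℝ) - p < Real.sqrt ((Δ : ℝ) ^ 2 - 4 * (n : ℝ)) := by
    apply Real.lt_sqrt_of_sq_lt
    rw [hΔ, hn]
    push_cast
    nlinarith [mul_pos hp' h1', mul_pos hq' h1', mul_pos h1' h1']
  have hD : (Δ : ℝ) = p + q + δ := by rw [hΔ]; push_cast; ring
  rw [hrp]
  linarith
end

section
/- Let p < q be primes, n = p·q, and e a natural number with 1 < e ≤ n. Set δ = ⌊log_e n⌋, Δ = p + q + δ, and r₋ = (Δ − √(Δ² − 4n))/2 (a real number; Δ² − 4n > 0). If δ < (2/3)·(3p − q) (as real numbers), then p − r₋ > δ/2. -/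
theorem coarse_grain_lower (p q n e : ℕ) (hp : p.Prime) (hq : q.Prime) (hpq : p < q)
    (hn : n = p * q) (he : 1 < e) (hen : e ≤ n)
    (δ : ℕ) (hδ : δ = Nat.log e n)
    (Δ : ℕ) (hΔ : Δ = p + q + δ)
    (rm : ℝ) (hrm : rm = ((Δ : ℝ) - Real.sqrt ((Δ : ℝ) ^ 2 - 4 * (n : ℝ))) / 2)
    (hsmall : (δ : ℝ) < (2 / 3) * (3 * (p : ℝ) - (q : ℝ))) :
    (p : ℝ) - rm > (δ : ℝ) / 2 := by
  have hd : 0 < δ := by rw [hδ]; exact Nat.log_pos he hen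
  have hd' : (0 : ℝ) < δ := by exact_mod_cast hd
  have hpq' : (p : ℝ) < q := by exact_mod_cast hpq
  have key : (q : ℝ) - p + 2 * δ < Real.sqrt ((Δ : ℝ) ^ 2 - 4 * (n : ℝ)) := by
    apply Real.lt_sqrt_of_sq_lt
    rw [hΔ, hn]
    push_cast
    have h : 0 < (δ : ℝ) * ((2 / 3) * (3 * (p : ℝ) - (q : ℝ)) - δ) :=
      mul_pos hd' (by linarith)
    nlinarith [h]
  have hΔ' : (Δ : ℝ) = p + q + δ := by rw [hΔ]; push_cast; ring
  rw [hrm]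
  linarith
end

section
/- Let p and q be distinct primes, n = p·q, and let e, d be positive natural numbers with e·d ≡ 1 (mod λ(n)). Then for every m in ZMod n, m^(e·d) = m. (Correctness of RSA encryption/decryption.) -/
theorem rsa_aux (r n k : ℕ) (hr : r.Prime) [NeZero n] (hrn : r ∣ n) (hk : 0 < k)
    (h : k ≡ 1 [MOD carmichael n]) (x : ZMod r) : x ^ k = x := by
  haveI : Fact r.Prime := ⟨hr⟩
  by_cases hx : x = 0
  · subst hx
    exact zero_pow hk.ne'
  · obtain ⟨u, hu⟩ := ZMod.unitsMap_surjective hrn (Units.mk0 x hx)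
    obtain ⟨c, hc⟩ := (Nat.modEq_iff_dvd' hk).1 h.symm
    have h1 : u ^ carmichael n = 1 := Monoid.pow_exponent_eq_one u
    have h2 : x ^ carmichael n = 1 := by
      have := congrArg (ZMod.unitsMap hrn) h1
      rw [map_pow, hu, map_one] at this
      simpa using congrArg Units.val this
    have h3 : k = carmichael n * c + 1 := by omega
    rw [h3, pow_succ, pow_mul, h2, one_pow, one_mul]

theorem rsa_correctness (p q n : ℕ) (hp : p.Prime) (hq : q.Prime) (hpq : p ≠ q)
    (hn : n = p * q) (e d : ℕ) (he : 0 < e) (hd : 0 < d)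
    (hed : e * d ≡ 1 [MOD carmichael n]) :
    ∀ m : ZMod n, m ^ (e * d) = m := by
  intro m
  subst hn
  haveI : NeZero (p * q) := ⟨mul_ne_zero hp.ne_zero hq.ne_zero⟩
  have hk : 0 < e * d := Nat.mul_pos he hd
  have hc : Nat.Coprime p q := (Nat.coprime_primes hp hq).2 hpq
  apply (ZMod.chineseRemainder hc).injective
  rw [map_pow]
  exact Prod.ext (rsa_aux p _ _ hp (dvd_mul_right p q) hk hed _)
    (rsa_aux q _ _ hq (dvd_mul_left q p) hk hed _)
end

section
/- Let p and q be distinct doubly safe primes with p ≠ 11 and q ≠ 11; that is, p, q are primes, (p−1)/2, (q−1)/2, (p−3)/4, (q−3)/4 are all prime (with 2 ∣ p−1, 4 ∣ p−3, 2 ∣ q−1, 4 ∣ q−3). Then λ(pq) = (p−1)(q−1)/2 and λ(λ(pq)) = (p−3)(q−3)/8. -/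
theorem carm_eq {n : ℕ} (hn : n ≠ 0) : carmichael n = ArithmeticFunction.carmichael n := by
  rw [ArithmeticFunction.carmichael_eq_exponent hn, carmichael]

theorem carm_prime {p : ℕ} (hp : p.Prime) : ArithmeticFunction.carmichael p = p - 1 := by
  haveI : Fact p.Prime := ⟨hp⟩
  rw [ArithmeticFunction.carmichael_eq_exponent hp.ne_zero, IsCyclic.exponent_eq_card,
    Nat.card_eq_fintype_card, ZMod.card_units_eq_totient, Nat.totient_prime hp]

theorem lcm_two {a b : ℕ} (ha : a.Prime) (hb : b.Prime) (h : a ≠ b) :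
    Nat.lcm (2 * a) (2 * b) = 2 * (a * b) := by
  rw [Nat.lcm_mul_left, ((Nat.coprime_primes ha hb).2 h).lcm_eq_mul]

theorem doubly_safe_carmichael (p q : ℕ) (hp : p.Prime) (hq : q.Prime) (hpq : p ≠ q)
    (hp2d : 2 ∣ p - 1) (hp2 : Nat.Prime ((p - 1) / 2))
    (hp4d : 4 ∣ p - 3) (hp4 : Nat.Prime ((p - 3) / 4))
    (hq2d : 2 ∣ q - 1) (hq2 : Nat.Prime ((q - 1) / 2))
    (hq4d : 4 ∣ q - 3) (hq4 : Nat.Prime ((q - 3) / 4))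
    (hpne : p ≠ 11) (hqne : q ≠ 11) :
    carmichael (p * q) = (p - 1) * (q - 1) / 2 ∧
    carmichael (carmichael (p * q)) = (p - 3) * (q - 3) / 8 := by
  obtain ⟨r, hr⟩ := hp4d
  obtain ⟨t, ht⟩ := hq4d
  have hr' : (p - 3) / 4 = r := by omega
  have ht' : (q - 3) / 4 = t := by omega
  rw [hr'] at hp4
  rw [ht'] at hq4
  have hr2 := hp4.two_le
  have ht2 := hq4.two_le
  obtain rfl : p = 4 * r + 3 := by omega
  obtain rfl : q = 4 * t + 3 := by omega
  have ea : (4 * r + 3 - 1) / 2 = 2 * r + 1 := by omega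
  have eb : (4 * t + 3 - 1) / 2 = 2 * t + 1 := by omega
  rw [ea] at hp2
  rw [eb] at hq2
  have e1 : 4 * r + 3 - 1 = 2 * (2 * r + 1) := by omega
  have e2 : 4 * t + 3 - 1 = 2 * (2 * t + 1) := by omega
  have key : carmichael ((4 * r + 3) * (4 * t + 3)) = 2 * ((2 * r + 1) * (2 * t + 1)) := by
    rw [carm_eq (by positivity), ArithmeticFunction.carmichael_mul
      ((Nat.coprime_primes hp hq).2 hpq), carm_prime hp, carm_prime hq, e1, e2,
      lcm_two hp2 hq2 (by omega)]
  refine ⟨?_, ?_⟩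
  · rw [key, e1, e2]
    symm
    apply Nat.div_eq_of_eq_mul_left (by norm_num)
    ring
  · have c2 : Nat.Coprime 2 ((2 * r + 1) * (2 * t + 1)) := by
      apply Nat.Coprime.mul_right <;> simp
    rw [key, carm_eq (by positivity), ArithmeticFunction.carmichael_mul c2,
      ArithmeticFunction.carmichael_mul ((Nat.coprime_primes hp2 hq2).2 (by omega)),
      carm_prime hp2, carm_prime hq2, carm_prime Nat.prime_two, Nat.add_sub_cancel,
      Nat.add_sub_cancel, lcm_two hp4 hq4 (by omega), Nat.add_sub_cancel, Nat.add_sub_cancel]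
    simp only [Nat.add_one_sub_one, Nat.lcm_one_left]
    symm
    apply Nat.div_eq_of_eq_mul_left (by norm_num)
    ring
end
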